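/- Let T1 and T2 be two comparable mixture trees on the same finite leaf set L with |L| ≥ 2. Then the mixture distance d_m(T1, T2) equals 0 if and only if T1 and T2 are identical, i.e., isomorphic as rooted leaf-labeled trees by an isomorphism that fixes every leaf label and preserves the mutation time of every internal node (children may be exchanged, since the trees are unordered for this purpose). -/

import Mathlib

/-- A rooted full binary tree with leaf labels of type `α` and a real
mutation time attached to every internal node. -/
inductive MTree (α : Type) where
  | leaf : α → MTree α
  | node : ℝ → MTree α → MTree α → MTree α

namespace MTree

variable {α : Type}

/-- The leaves of the tree, in left-to-right order. -/
def leafList : MTree α → List α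
  | leaf a => [a]
  | node _ l r => leafList l ++ leafList r

/-- The mutation time at the root (0 for a leaf; only used on internal nodes). -/
def rootTime : MTree α → ℝ
  | leaf _ => 0
  | node m _ _ => m

/-- All mutation times are positive. -/
def timesPos : MTree α → Prop
  | leaf _ => True
  | node m l r => 0 < m ∧ timesPos l ∧ timesPos r

/-- The root mutation time of `t` (if any) is smaller than `m`. -/
def timeLT (m : ℝ) : MTree α → Prop
  | leaf _ => True
  | node m' _ _ => m' < m

/-- Mutation times strictly decrease along every root-to-leaf path. -/
def decreasing : MTree α → Prop
  | leaf _ => True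
  | node m l r => timeLT m l ∧ timeLT m r ∧ decreasing l ∧ decreasing r

/-- A mixture tree: leaves carry pairwise distinct labels, the mutation times are
positive and strictly decrease along every root-to-leaf path. -/
def Valid (t : MTree α) : Prop := t.leafList.Nodup ∧ t.timesPos ∧ t.decreasing

/-- `P_T(u, v)`: the mutation time of the least common ancestor of leaves `u`
and `v` in `T`. -/
noncomputable def lcaTime [DecidableEq α] : MTree α → α → α → ℝ
  | leaf _, _, _ => 0
  | node m l r, u, v =>
    if u ∈ l.leafList ∧ v ∈ l.leafList then lcaTime l u v
    else if u ∈ r.leafList ∧ v ∈ r.leafList then lcaTime r u v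
    else m

/-- `Subtree s t`: `s` occurs as a (rooted) subtree of `t`; equivalently, the
root of `s` is a node of `t` and `s` is the part of `t` hanging below it. -/
inductive Subtree : MTree α → MTree α → Prop
  | refl (t : MTree α) : Subtree t t
  | left {s l r : MTree α} {m : ℝ} : Subtree s l → Subtree s (node m l r)
  | right {s l r : MTree α} {m : ℝ} : Subtree s r → Subtree s (node m l r)

/-- `IsLCA T u v w`: the node (subtree) `w` of `T` is the graph-theoretic least
common ancestor of the leaves `u` and `v`: it is a common ancestor of both, and a
descendant of every common ancestor of both. -/
def IsLCA (T : MTree α) (u v : α) (w : MTree α) : Prop :=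
  Subtree w T ∧ u ∈ w.leafList ∧ v ∈ w.leafList ∧
    ∀ w' : MTree α, Subtree w' T → u ∈ w'.leafList → v ∈ w'.leafList → Subtree w w'

end MTree

/-- The mixture distance between two comparable mixture trees on leaf set `L`:
the sum over unordered pairs of distinct leaves of the absolute difference of
the LCA mutation times (each unordered pair appears twice in `L.offDiag`,
whence the division by 2). -/
noncomputable def mixtureDist {α : Type} [DecidableEq α] (L : Finset α) (T₁ T₂ : MTree α) : ℝ :=
  (∑ p ∈ L.offDiag, |MTree.lcaTime T₁ p.1 p.2 - MTree.lcaTime T₂ p.1 p.2|) / 2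

/-- `Iso T₁ T₂`: `T₁` and `T₂` are identical as rooted leaf-labeled mixture trees,
i.e. isomorphic by an isomorphism fixing every leaf label and preserving the
mutation time of every internal node; children may be exchanged (the trees are
regarded as unordered). -/
inductive MTree.Iso {α : Type} : MTree α → MTree α → Prop
  | leaf (a : α) : Iso (.leaf a) (.leaf a)
  | node {l₁ r₁ l₂ r₂ : MTree α} (m : ℝ) :
      Iso l₁ l₂ → Iso r₁ r₂ → Iso (.node m l₁ r₁) (.node m l₂ r₂)
  | swap {l₁ r₁ l₂ r₂ : MTree α} (m : ℝ) :
      Iso l₁ l₂ → Iso r₁ r₂ → Iso (.node m l₁ r₁) (.node m r₂ l₂)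

namespace MTree

theorem exists_mem {α : Type} (t : MTree α) : ∃ a, a ∈ t.leafList := by
  induction t with
  | leaf a => exact ⟨a, by simp [leafList]⟩
  | node m l r ihl ihr =>
    obtain ⟨a, ha⟩ := ihl
    exact ⟨a, by simp [leafList, ha]⟩

theorem lcaTime_lt {α : Type} [DecidableEq α] (t : MTree α) (u v : α) :
    ∀ m : ℝ, 0 < m → timeLT m t → t.timesPos → t.decreasing → lcaTime t u v < m := by
  induction t with
  | leaf a => intro m hm _ _ _; simpa [lcaTime] using hm
  | node m' l r ihl ihr =>
    intro m hm hlt hp hd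
    obtain ⟨h0, hpl, hpr⟩ := hp
    obtain ⟨hl, hr, hdl, hdr⟩ := hd
    have h1 := ihl m' h0 hl hpl hdl
    have h2 := ihr m' h0 hr hpr hdr
    simp only [timeLT] at hlt
    simp only [lcaTime]
    split_ifs <;> linarith

theorem Valid.left {α : Type} {m : ℝ} {l r : MTree α} (h : (node m l r).Valid) : l.Valid :=
  ⟨(List.nodup_append.1 h.1).1, h.2.1.2.1, h.2.2.2.2.1⟩

theorem Valid.right {α : Type} {m : ℝ} {l r : MTree α} (h : (node m l r).Valid) : r.Valid :=
  ⟨(List.nodup_append.1 h.1).2.1, h.2.1.2.2, h.2.2.2.2.2⟩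

theorem Valid.disj {α : Type} {m : ℝ} {l r : MTree α} (h : (node m l r).Valid) (a : α)
    (h1 : a ∈ l.leafList) (h2 : a ∈ r.leafList) : False :=
  (List.nodup_append.1 h.1).2.2 a h1 a h2 rfl

theorem Valid.lt_left {α : Type} [DecidableEq α] {m : ℝ} {l r : MTree α}
    (h : (node m l r).Valid) (u v : α) : lcaTime l u v < m :=
  lcaTime_lt l u v m h.2.1.1 h.2.2.1 h.2.1.2.1 h.2.2.2.2.1

theorem Valid.lt_right {α : Type} [DecidableEq α] {m : ℝ} {l r : MTree α}
    (h : (node m l r).Valid) (u v : α) : lcaTime r u v < m :=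
  lcaTime_lt r u v m h.2.1.1 h.2.2.2.1 h.2.1.2.2 h.2.2.2.2.2

theorem Iso.mem_iff {α : Type} {s t : MTree α} (h : Iso s t) (a : α) :
    a ∈ s.leafList ↔ a ∈ t.leafList := by
  induction h with
  | leaf b => rfl
  | node m _ _ ih1 ih2 => simp [leafList, ih1, ih2]
  | swap m _ _ ih1 ih2 => simp [leafList, ih1, ih2, or_comm]

theorem Iso.lcaTime_eq {α : Type} [DecidableEq α] {s t : MTree α} (h : Iso s t)
    (hs : s.Valid) (u v : α) : lcaTime s u v = lcaTime t u v := by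
  induction h with
  | leaf b => rfl
  | node m h1 h2 ih1 ih2 =>
    simp only [lcaTime, ih1 hs.left, ih2 hs.right, h1.mem_iff, h2.mem_iff]
  | swap m h1 h2 ih1 ih2 =>
    have hd := hs.disj u
    simp only [lcaTime, ih1 hs.left, ih2 hs.right, h1.mem_iff, h2.mem_iff] at hd ⊢
    split_ifs <;> tauto

theorem lca_lt_iff {α : Type} [DecidableEq α] {m : ℝ} {l r : MTree α}
    (h : (node m l r).Valid) (u v : α) : lcaTime (node m l r) u v < m ↔
      (u ∈ l.leafList ∧ v ∈ l.leafList) ∨ (u ∈ r.leafList ∧ v ∈ r.leafList) := by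
  have h1 := h.lt_left u v
  have h2 := h.lt_right u v
  simp only [lcaTime]
  split_ifs <;> simp_all

theorem lca_le {α : Type} [DecidableEq α] {m : ℝ} {l r : MTree α}
    (h : (node m l r).Valid) (u v : α) : lcaTime (node m l r) u v ≤ m := by
  have h1 := h.lt_left u v
  have h2 := h.lt_right u v
  simp only [lcaTime]
  split_ifs <;> linarith

theorem lca_left {α : Type} [DecidableEq α] {m : ℝ} {l r : MTree α} {u v : α}
    (hu : u ∈ l.leafList) (hv : v ∈ l.leafList) :
    lcaTime (node m l r) u v = lcaTime l u v := by
  simp [lcaTime, hu, hv]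

theorem lca_right {α : Type} [DecidableEq α] {m : ℝ} {l r : MTree α} {u v : α}
    (h : (node m l r).Valid)
    (hu : u ∈ r.leafList) (hv : v ∈ r.leafList) :
    lcaTime (node m l r) u v = lcaTime r u v := by
  have : u ∉ l.leafList := fun h' => h.disj u h' hu
  simp [lcaTime, hu, hv, this]

theorem root_le {α : Type} [DecidableEq α] {m m' : ℝ} {l r l' r' : MTree α}
    (h : (node m l r).Valid) (h' : (node m' l' r').Valid)
    (he : ∀ u ∈ (node m l r).leafList, ∀ v ∈ (node m l r).leafList, u ≠ v →
      lcaTime (node m l r) u v = lcaTime (node m' l' r') u v) : m ≤ m' := by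
  obtain ⟨a, ha⟩ := exists_mem l
  obtain ⟨b, hb⟩ := exists_mem r
  have hne : a ≠ b := by rintro rfl; exact h.disj a ha hb
  have h1 := he a (by simp [leafList, ha]) b (by simp [leafList, hb]) hne
  have h2 := lca_le h' a b
  have h3 : ¬ lcaTime (node m l r) a b < m := by
    rw [lca_lt_iff h]
    rintro (⟨_, h4⟩ | ⟨h4, _⟩)
    · exact h.disj b h4 hb
    · exact h.disj a ha h4
  linarith

set_option maxHeartbeats 1000000 in
theorem iso_of_lca {α : Type} [DecidableEq α] (s : MTree α) : ∀ t : MTree α,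
    s.Valid → t.Valid → (∀ a, a ∈ s.leafList ↔ a ∈ t.leafList) →
    (∀ u ∈ s.leafList, ∀ v ∈ s.leafList, u ≠ v → lcaTime s u v = lcaTime t u v) →
    Iso s t := by
  induction s with
  | leaf a =>
    intro t hs ht hm he
    cases t with
    | leaf b =>
      have := (hm a).1 (by simp [leafList])
      simp only [leafList, List.mem_singleton] at this
      subst this
      exact .leaf a
    | node m l r =>
      exfalso
      obtain ⟨x, hx⟩ := exists_mem l
      obtain ⟨y, hy⟩ := exists_mem r
      have h1 := (hm x).2 (by simp [leafList, hx])
      have h2 := (hm y).2 (by simp [leafList, hy])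
      simp only [leafList, List.mem_singleton] at h1 h2
      subst h1 h2
      exact ht.disj _ hx hy
  | node m l r ihl ihr =>
    intro t hs ht hm he
    cases t with
    | leaf b =>
      exfalso
      obtain ⟨x, hx⟩ := exists_mem l
      obtain ⟨y, hy⟩ := exists_mem r
      have h1 := (hm x).1 (by simp [leafList, hx])
      have h2 := (hm y).1 (by simp [leafList, hy])
      simp only [leafList, List.mem_singleton] at h1 h2
      subst h1 h2
      exact hs.disj _ hx hy
    | node m' l' r' =>
      have hmm : m = m' := by
        refine le_antisymm (root_le hs ht he) (root_le ht hs ?_)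
        intro u hu v hv huv
        exact (he u ((hm u).2 hu) v ((hm v).2 hv) huv).symm
      subst hmm
      have hside : ∀ u ∈ (node m l r).leafList, ∀ v ∈ (node m l r).leafList, u ≠ v →
          (((u ∈ l.leafList ∧ v ∈ l.leafList) ∨ (u ∈ r.leafList ∧ v ∈ r.leafList)) ↔
          ((u ∈ l'.leafList ∧ v ∈ l'.leafList) ∨ (u ∈ r'.leafList ∧ v ∈ r'.leafList))) := by
        intro u hu v hv huv
        rw [← lca_lt_iff hs, ← lca_lt_iff ht, he u hu v hv huv]
      have hm' : ∀ a, (a ∈ l.leafList ∨ a ∈ r.leafList) ↔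
          (a ∈ l'.leafList ∨ a ∈ r'.leafList) := by
        intro a; simpa [leafList] using hm a
      have hds := hs.disj
      have hdt := ht.disj
      have hml : ∀ a ∈ l.leafList, a ∈ (node m l r).leafList := by
        intro a ha; simp [leafList, ha]
      have hmr : ∀ a ∈ r.leafList, a ∈ (node m l r).leafList := by
        intro a ha; simp [leafList, ha]
      obtain ⟨a, ha⟩ := exists_mem l
      have hsa : ∀ v, v ∈ (node m l r).leafList → a ≠ v → _ :=
        fun v hv => hside a (hml a ha) v hv
      rcases (hm' a).1 (Or.inl ha) with ha' | ha'
      · have hl : ∀ x, x ∈ l.leafList ↔ x ∈ l'.leafList := by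
          intro x
          by_cases hx : a = x
          · subst hx; tauto
          have := hml x; have := hmr x; have := hsa x; have := hm' x
          have := hds a; have := hdt a
          grind
        have hr : ∀ x, x ∈ r.leafList ↔ x ∈ r'.leafList := by
          intro x
          have := hl x; have := hm' x; have := hds x; have := hdt x
          grind
        refine .node m (ihl l' hs.left ht.left hl ?_) (ihr r' hs.right ht.right hr ?_)
        · intro u hu v hv huv
          have := he u (hml u hu) v (hml v hv) huv
          rwa [lca_left hu hv, lca_left ((hl u).1 hu) ((hl v).1 hv)] at this
        · intro u hu v hv huv
          have := he u (hmr u hu) v (hmr v hv) huv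
          rwa [lca_right hs hu hv, lca_right ht ((hr u).1 hu) ((hr v).1 hv)] at this
      · have hl : ∀ x, x ∈ l.leafList ↔ x ∈ r'.leafList := by
          intro x
          by_cases hx : a = x
          · subst hx; tauto
          have := hml x; have := hmr x; have := hsa x; have := hm' x
          have := hds a; have := hdt a
          grind
        have hr : ∀ x, x ∈ r.leafList ↔ x ∈ l'.leafList := by
          intro x
          have := hl x; have := hm' x; have := hds x; have := hdt x
          grind
        refine .swap m (ihl r' hs.left ht.right hl ?_) (ihr l' hs.right ht.left hr ?_)
        · intro u hu v hv huv
          have := he u (hml u hu) v (hml v hv) huv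
          rwa [lca_left hu hv, lca_right ht ((hl u).1 hu) ((hl v).1 hv)] at this
        · intro u hu v hv huv
          have := he u (hmr u hu) v (hmr v hv) huv
          rwa [lca_right hs hu hv, lca_left ((hr u).1 hu) ((hr v).1 hv)] at this

end MTree

/-- **Reflexivity of the mixture distance.** For two comparable mixture trees
`T₁` and `T₂` on the same finite leaf set `L` with `|L| ≥ 2`, the mixture
distance is `0` iff `T₁` and `T₂` are identical (isomorphic as rooted
leaf-labeled trees, preserving mutation times, children possibly exchanged). -/
theorem mixtureDist_eq_zero_iff_iso {α : Type} [DecidableEq α]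
    (L : Finset α) (hL : 2 ≤ L.card) (T₁ T₂ : MTree α)
    (hv₁ : T₁.Valid) (hv₂ : T₂.Valid)
    (hL₁ : T₁.leafList.toFinset = L) (hL₂ : T₂.leafList.toFinset = L) :
    mixtureDist L T₁ T₂ = 0 ↔ MTree.Iso T₁ T₂ := by
  constructor
  · intro h
    have h0 : ∑ p ∈ L.offDiag, |MTree.lcaTime T₁ p.1 p.2 - MTree.lcaTime T₂ p.1 p.2| = 0 := by
      unfold mixtureDist at h
      linarith
    rw [Finset.sum_eq_zero_iff_of_nonneg (fun _ _ => abs_nonneg _)] at h0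
    have hm₁ : ∀ a, a ∈ T₁.leafList ↔ a ∈ L := by
      intro a; rw [← hL₁, List.mem_toFinset]
    have hm₂ : ∀ a, a ∈ T₂.leafList ↔ a ∈ L := by
      intro a; rw [← hL₂, List.mem_toFinset]
    refine MTree.iso_of_lca T₁ T₂ hv₁ hv₂ (fun a => (hm₁ a).trans (hm₂ a).symm) ?_
    intro u hu v hv huv
    have := h0 (u, v) (Finset.mem_offDiag.2 ⟨(hm₁ u).1 hu, (hm₁ v).1 hv, huv⟩)
    exact sub_eq_zero.1 (abs_eq_zero.1 this)
  · intro h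
    simp [mixtureDist, h.lcaTime_eq hv₁]
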